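/- Let h be a primitive vector of square 2d and divisibility γ in L_{2t} = M ⊕ U ⊕ Zℓ (M even unimodular, ℓ² = −2t). Then the class of k₁ = (γ/2d)h − f in A_{h^⊥} has order 2d/γ, the group H = L_{2t}/(Zh ⊕ h^⊥) is cyclic generated by [f] with |H| = 2d/γ, and consequently |A_{h^⊥}| = (2d/γ)(2t/γ). -/

import Mathlib

/-- The dual lattice of a `ℤ`-lattice `N` inside the `ℚ`-subspace `W` of `V`, with respect
to the bilinear form `B`: rational vectors of `W` pairing integrally with `N`. -/
def dualIn {V : Type*} [AddCommGroup V] [Module ℚ V]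
    (B : LinearMap.BilinForm ℚ V) (W : Submodule ℚ V) (N : Submodule ℤ V) :
    Submodule ℤ V where
  carrier := {x | x ∈ W ∧ ∀ y ∈ N, ∃ n : ℤ, B x y = n}
  zero_mem' := ⟨W.zero_mem, fun y _ => ⟨0, by simp⟩⟩
  add_mem' := by
    rintro a b ⟨haW, ha⟩ ⟨hbW, hb⟩
    refine ⟨W.add_mem haW hbW, fun y hy => ?_⟩
    obtain ⟨n, hn⟩ := ha y hy
    obtain ⟨m, hm⟩ := hb y hy
    exact ⟨n + m, by rw [map_add, LinearMap.add_apply, hn, hm]; push_cast; ring⟩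
  smul_mem' := by
    rintro z x ⟨hxW, hx⟩
    refine ⟨(W.restrictScalars ℤ).smul_mem z hxW, fun y hy => ?_⟩
    obtain ⟨n, hn⟩ := hx y hy
    refine ⟨z * n, ?_⟩
    rw [map_zsmul, LinearMap.smul_apply, hn, zsmul_eq_mul]
    push_cast
    ring

open Matrix

/-- The index of the image of an injective endomorphism of a finite free `ℤ`-module is the
absolute value of its determinant. -/
theorem LinearMap.card_quotient_range_of_injective {M : Type*} [AddCommGroup M]
    [Module.Free ℤ M] [Module.Finite ℤ M] (f : M →ₗ[ℤ] M) (hf : Function.Injective f) :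
    Nat.card (M ⧸ LinearMap.range f) = (LinearMap.det f).natAbs := by
  rw [← Submodule.natAbs_det_equiv (LinearMap.range f) (LinearEquiv.ofInjective f hf)]
  rfl

theorem addOrderOf_eq_toNat {G : Type*} [AddGroup G] {x : G} {D : ℤ} (hD : 0 ≤ D)
    (hx : ∀ n : ℤ, n • x = 0 ↔ D ∣ n) : addOrderOf x = D.toNat := by
  have key : ∀ n : ℤ, (addOrderOf x : ℤ) ∣ n ↔ D ∣ n := fun n => by
    rw [addOrderOf_dvd_iff_zsmul_eq_zero, hx]
  have h1 := (key D).2 dvd_rfl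
  have h2 := (key (addOrderOf x)).1 dvd_rfl
  have := Int.dvd_antisymm (Int.natCast_nonneg _) hD h1 h2
  omega

/-- The form of the orthogonal sum of a lattice with Gram matrix `A`, a hyperbolic plane and a
rank one lattice, in coordinates. -/
theorem Matrix.toBilin'_fromBlocks_hyperbolic {r : ℕ} (A : Matrix (Fin r) (Fin r) ℚ) (m : ℚ)
    (x y : (Fin r ⊕ Fin 3) → ℚ) :
    Matrix.toBilin' (Matrix.fromBlocks A 0 0 !![0, 1, 0; 1, 0, 0; 0, 0, m]) x y =
      (fun i => x (.inl i)) ⬝ᵥ (A *ᵥ fun i => y (.inl i)) + x (.inr 0) * y (.inr 1) +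
        x (.inr 1) * y (.inr 0) + m * x (.inr 2) * y (.inr 2) := by
  simp [Matrix.toBilin'_apply', dotProduct, Fin.sum_univ_three, Matrix.mulVec]
  ring

/-- Over a unimodular Gram matrix, a rational vector pairing integrally with the standard basis
is integral. -/
theorem Matrix.exists_intCast_of_vecMul {n : Type*} [Fintype n] [DecidableEq n]
    (A : Matrix n n ℤ) (hA : IsUnit A.det) (x : n → ℚ)
    (hx : ∀ i, ∃ m : ℤ, (x ᵥ* A.map (Int.cast : ℤ → ℚ)) i = m) (i : n) :
    ∃ m : ℤ, (m : ℚ) = x i := by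
  choose m hm using hx
  have hmul : A.map (Int.cast : ℤ → ℚ) * A⁻¹.map (Int.cast : ℤ → ℚ) = 1 := by
    have := congrArg (fun C : Matrix n n ℤ => C.map (Int.castRingHom ℚ)) (A.mul_nonsing_inv hA)
    rwa [Matrix.map_mul, Matrix.map_one _ (map_zero _) (map_one _)] at this
  refine ⟨(m ᵥ* A⁻¹) i, ?_⟩
  have hx' : x = (x ᵥ* A.map (Int.cast : ℤ → ℚ)) ᵥ* A⁻¹.map (Int.cast : ℤ → ℚ) := by
    rw [Matrix.vecMul_vecMul, hmul, Matrix.vecMul_one]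
  rw [hx', funext hm]
  simp [Matrix.vecMul, dotProduct]

/-- If `gcd c γ = 1`, then `n c / D` and `n γ / D` are both integers only if `D ∣ n`. -/
theorem Int.dvd_of_dvd_mul_of_dvd_mul {D n c γ : ℤ} (hcop : Int.gcd c γ = 1)
    (h₁ : D ∣ n * c) (h₂ : D ∣ n * γ) : D ∣ n := by
  have hb := Int.gcd_eq_gcd_ab c γ
  rw [hcop] at hb
  have : n = n * c * Int.gcdA c γ + n * γ * Int.gcdB c γ := by
    linear_combination n * hb
  rw [this]
  exact dvd_add (h₁.mul_right _) (h₂.mul_right _)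

/-!
STATEMENT 9. `L_{2t} = M ⊕ U ⊕ ℤℓ` is modeled as the lattice `L` of integral vectors in
`V = (Fin r ⊕ Fin 3) → ℚ`, with Gram matrix the block sum of an even unimodular `GM` and
`!![0,1,0; 1,0,0; 0,0,-2t]` (basis `e, f, ℓ`).  Let `h = γ(e + bf) + cℓ` be primitive of
square `2d` and divisibility `γ`.  Then the class of `k₁ = (γ/2d)h - f` in the
discriminant group `A_{h^⊥} = (h^⊥)^∨/h^⊥` has order `2d/γ`; the group
`H = L/(ℤh ⊕ h^⊥)` is cyclic, generated by the class of `f`, of order `|H| = 2d/γ`;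
and consequently `|A_{h^⊥}| = (2d/γ)(2t/γ)`.
-/
theorem stmt_9 (r : ℕ) (t d : ℤ) (ht : 0 < t) (hd : 0 < d)
    (GM : Matrix (Fin r) (Fin r) ℤ) (hsymm : GM.IsSymm) (heven : ∀ i, 2 ∣ GM i i)
    (hunimod : IsUnit GM.det)
    (B : LinearMap.BilinForm ℚ ((Fin r ⊕ Fin 3) → ℚ))
    (hB : B = Matrix.toBilin' (Matrix.fromBlocks (GM.map (Int.cast : ℤ → ℚ)) 0 0
      !![0, 1, 0; 1, 0, 0; 0, 0, -(2 * (t : ℚ))]))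
    (L : Submodule ℤ ((Fin r ⊕ Fin 3) → ℚ))
    (hL : L = Submodule.pi Set.univ (fun _ => Submodule.span ℤ {(1 : ℚ)}))
    (γ b c : ℤ) (hc0 : 0 ≤ c) (hcγ : c < γ) (hcop : Int.gcd c γ = 1)
    (hγ2t : γ ∣ 2 * t) (hsq : 2 * d = 2 * γ ^ 2 * b - 2 * t * c ^ 2)
    (h fvec k₁ : (Fin r ⊕ Fin 3) → ℚ)
    (hh : h = Sum.elim (0 : Fin r → ℚ) ![(γ : ℚ), (γ : ℚ) * b, (c : ℚ)])
    (hf : fvec = Sum.elim (0 : Fin r → ℚ) ![0, 1, 0])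
    (hk₁ : k₁ = ((γ : ℚ) / (2 * d)) • h - fvec)
    (hperpLat : Submodule ℤ ((Fin r ⊕ Fin 3) → ℚ))
    (hperpLat_def : hperpLat = L ⊓ (LinearMap.ker (B h)).restrictScalars ℤ)
    (dual : Submodule ℤ ((Fin r ⊕ Fin 3) → ℚ))
    (hdual : dual = dualIn B (LinearMap.ker (B h)) hperpLat)
    (hk₁mem : k₁ ∈ dual) (hfmem : fvec ∈ L) :
    addOrderOf (Submodule.Quotient.mk (⟨k₁, hk₁mem⟩ : dual) :
        dual ⧸ hperpLat.comap dual.subtype) = (2 * d / γ).toNat ∧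
      (∀ x : L ⧸ (Submodule.span ℤ {h} ⊔ hperpLat).comap L.subtype,
        x ∈ AddSubgroup.zmultiples
          (Submodule.Quotient.mk (⟨fvec, hfmem⟩ : L))) ∧
      Nat.card (L ⧸ (Submodule.span ℤ {h} ⊔ hperpLat).comap L.subtype) =
        (2 * d / γ).toNat ∧
      Nat.card (dual ⧸ hperpLat.comap dual.subtype) =
        ((2 * d / γ) * (2 * t / γ)).toNat := by
  have hγ : 0 < γ := hc0.trans_lt hcγ
  obtain ⟨s, hs⟩ := hγ2t
  obtain ⟨D, hD⟩ : ∃ D, D = 2 * γ * b - s * c ^ 2 := ⟨_, rfl⟩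
  have hdD : 2 * d = γ * D := by rw [hD, hsq, hs]; ring
  have hspos : 0 < s := by
    by_contra! hle
    nlinarith
  have hDpos : 0 < D := by
    by_contra! hle
    nlinarith
  rw [hdD, hs, Int.mul_ediv_cancel_left _ hγ.ne', Int.mul_ediv_cancel_left _ hγ.ne']
  have hγQ : (γ : ℚ) ≠ 0 := mod_cast hγ.ne'
  have hDQ0 : (D : ℚ) ≠ 0 := mod_cast hDpos.ne'
  have hsQ : 2 * (t : ℚ) = γ * s := mod_cast hs
  have hDQ : (D : ℚ) = 2 * γ * b - s * c ^ 2 := mod_cast hD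
  have hBapply : ∀ x y, B x y = (fun i => x (.inl i)) ⬝ᵥ
      (GM.map (Int.cast : ℤ → ℚ) *ᵥ fun i => y (.inl i)) + x (.inr 0) * y (.inr 1) +
        x (.inr 1) * y (.inr 0) - γ * s * x (.inr 2) * y (.inr 2) := fun x y => by
    rw [hB, Matrix.toBilin'_fromBlocks_hyperbolic, hsQ]
    ring
  have hBh : ∀ y, B h y = γ * (y (.inr 1) + b * y (.inr 0) - s * c * y (.inr 2)) := fun y => by
    rw [hBapply, hh]
    simp [dotProduct]
    ring
  have memL : ∀ x, x ∈ L ↔ ∀ i, ∃ n : ℤ, (n : ℚ) = x i := fun x => by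
    simp [hL, Submodule.mem_pi, Submodule.mem_span_singleton]
  have memKer : ∀ x, x ∈ LinearMap.ker (B h) ↔
      x (.inr 1) + b * x (.inr 0) - s * c * x (.inr 2) = 0 := fun x => by
    rw [LinearMap.mem_ker, hBh]
    simp [hγQ]
  have memPerp : ∀ x, x ∈ hperpLat ↔ (∀ i, ∃ n : ℤ, (n : ℚ) = x i) ∧
      x (.inr 1) + b * x (.inr 0) - s * c * x (.inr 2) = 0 := fun x => by
    rw [hperpLat_def, Submodule.mem_inf, memL, Submodule.restrictScalars_mem, memKer]
  have memDual : ∀ x, x ∈ dual ↔ x (.inr 1) + b * x (.inr 0) - s * c * x (.inr 2) = 0 ∧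
      ∀ y ∈ hperpLat, ∃ n : ℤ, B x y = n := fun x => by
    rw [← memKer, hdual]
    rfl
  have hk₁D : k₁ = (1 / (D : ℚ)) • h - fvec := by
    have : 2 * (d : ℚ) = γ * D := mod_cast hdD
    rw [hk₁, this]
    congr 2
    field_simp
  have hordf : addOrderOf (Submodule.Quotient.mk (⟨fvec, hfmem⟩ : L) :
      L ⧸ (Submodule.span ℤ {h} ⊔ hperpLat).comap L.subtype) = D.toNat := by
    refine addOrderOf_eq_toNat hDpos.le fun n => ?_
    rw [← Submodule.Quotient.mk_smul, Submodule.Quotient.mk_eq_zero, Submodule.mem_comap,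
      Submodule.mem_sup]
    simp only [Submodule.mem_span_singleton, memPerp]
    constructor
    · rintro ⟨_, ⟨a, rfl⟩, z, ⟨-, hz⟩, haz⟩
      have h0 := congrFun haz (.inr 0)
      have h1 := congrFun haz (.inr 1)
      have h2 := congrFun haz (.inr 2)
      simp [hh, hf] at h0 h1 h2
      refine ⟨a, ?_⟩
      have : (n : ℚ) = D * a := by
        rw [hDQ]; linear_combination hz - b * h0 - h1 + s * c * h2
      exact_mod_cast this
    · rintro ⟨a, rfl⟩
      refine ⟨a • h, ⟨a, rfl⟩, (D * a) • fvec - a • h, ⟨?_, ?_⟩, by simp⟩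
      · rintro (i | i)
        · exact ⟨0, by simp [hh, hf]⟩
        · fin_cases i
          · exact ⟨-(a * γ), by simp [hh, hf]⟩
          · exact ⟨D * a - a * (γ * b), by simp [hh, hf]⟩
          · exact ⟨-(a * c), by simp [hh, hf]⟩
      · simp [hh, hf, hDQ]
        ring
  have hgenf : ∀ x : L ⧸ (Submodule.span ℤ {h} ⊔ hperpLat).comap L.subtype,
      x ∈ AddSubgroup.zmultiples (Submodule.Quotient.mk (⟨fvec, hfmem⟩ : L)) := by
    intro x
    obtain ⟨⟨x, hx⟩, rfl⟩ := Submodule.Quotient.mk_surjective _ x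
    have hxL := (memL x).1 hx
    obtain ⟨x0, h0⟩ := hxL (.inr 0)
    obtain ⟨x1, h1⟩ := hxL (.inr 1)
    obtain ⟨x2, h2⟩ := hxL (.inr 2)
    refine AddSubgroup.mem_zmultiples_iff.2 ⟨x1 + b * x0 - s * c * x2, ?_⟩
    rw [← Submodule.Quotient.mk_smul, eq_comm, Submodule.Quotient.eq, Submodule.mem_comap]
    refine Submodule.mem_sup_right ((memPerp _).2 ⟨(memL _).1 ?_, ?_⟩)
    · exact L.sub_mem hx (L.smul_mem _ hfmem)
    · simp [hf, ← h0, ← h1, ← h2]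
      ring
  refine ⟨?_, hgenf, ?_, ?_⟩
  · refine addOrderOf_eq_toNat hDpos.le fun n => ?_
    rw [← Submodule.Quotient.mk_smul, Submodule.Quotient.mk_eq_zero, Submodule.mem_comap, memPerp]
    constructor
    · rintro ⟨hint, -⟩
      obtain ⟨p, hp⟩ := hint (.inr 0)
      obtain ⟨q, hq⟩ := hint (.inr 2)
      simp [hk₁D, hh, hf] at hp hq
      field_simp at hp hq
      refine Int.dvd_of_dvd_mul_of_dvd_mul hcop ⟨q, ?_⟩ ⟨p, ?_⟩
      · have : (n : ℚ) * c = D * q := by linear_combination -hq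
        exact_mod_cast this
      · have : (n : ℚ) * γ = D * p := by linear_combination -hp
        exact_mod_cast this
    · rintro ⟨a, rfl⟩
      refine ⟨?_, ?_⟩
      · rintro (i | i)
        · exact ⟨0, by simp [hk₁D, hh, hf]⟩
        · fin_cases i
          · exact ⟨a * γ, by simp [hk₁D, hh, hf]; field_simp⟩
          · exact ⟨a * (γ * b) - D * a, by simp [hk₁D, hh, hf]; field_simp⟩
          · exact ⟨a * c, by simp [hk₁D, hh, hf]; field_simp⟩
      · simp [hk₁D, hh, hf]
        field_simp
        rw [hDQ]
        ring
  · rw [← hordf, ← Nat.card_zmultiples, (AddSubgroup.eq_top_iff' _).2 hgenf]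
    exact (Nat.card_congr AddSubgroup.topEquiv.toEquiv).symm
  · -- The rank two part of `h^⊥` has basis `(1, -b, 0)`, `(0, s c, 1)` and Gram matrix `G`.
    let G : Matrix (Fin 2) (Fin 2) ℤ := !![-2 * b, s * c; s * c, -(γ * s)]
    have hdetG : G.det = D * s := by
      simp [G, Matrix.det_fin_two, hD]
      ring
    have hsQ0 : (s : ℚ) ≠ 0 := mod_cast hspos.ne'
    let w : (Fin 2 → ℤ) →ₗ[ℤ] ((Fin r ⊕ Fin 3) → ℚ) :=
      (AddMonoidHom.mk' (fun p => Sum.elim (0 : Fin r → ℚ)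
        ![-(γ * p 0 + c * p 1) / D,
          b * (γ * p 0 + c * p 1) / D - c * (2 * b * p 1 + s * c * p 0) / D,
          -(2 * b * p 1 + s * c * p 0) / (s * D)]) (by
        intro p q
        ext i
        rcases i with i | i
        · simp
        · fin_cases i <;> simp <;> ring)).toIntLinearMap
    have hw : ∀ p, w p = Sum.elim (0 : Fin r → ℚ)
        ![-(γ * p 0 + c * p 1) / D,
          b * (γ * p 0 + c * p 1) / D - c * (2 * b * p 1 + s * c * p 0) / D,
          -(2 * b * p 1 + s * c * p 0) / (s * D)] := fun p => rfl
    have hwker : ∀ p, w p (.inr 1) + b * w p (.inr 0) - s * c * w p (.inr 2) = 0 := fun p => by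
      simp [hw]
      field_simp
      ring
    have hpair0 : ∀ p, -2 * b * w p (.inr 0) + s * c * w p (.inr 2) = p 0 := fun p => by
      simp [hw]
      field_simp
      rw [hDQ]
      ring
    have hpair1 : ∀ p, s * c * w p (.inr 0) - γ * s * w p (.inr 2) = p 1 := fun p => by
      simp [hw]
      field_simp
      rw [hDQ]
      ring
    have hwdual : ∀ p, w p ∈ dual := fun p => by
      refine (memDual _).2 ⟨hwker p, fun y hy => ?_⟩
      obtain ⟨hyL, hy⟩ := (memPerp y).1 hy
      obtain ⟨y0, h0⟩ := hyL (.inr 0)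
      obtain ⟨y2, h2⟩ := hyL (.inr 2)
      refine ⟨y0 * p 0 + y2 * p 1, ?_⟩
      have hinl : (fun i => w p (.inl i)) = 0 := rfl
      rw [hBapply, hinl, zero_dotProduct]
      push_cast
      rw [← hpair0, ← hpair1, h0, h2]
      linear_combination w p (.inr 0) * hy + y (.inr 0) * hwker p
    let Ψ := (hperpLat.comap dual.subtype).mkQ ∘ₗ w.codRestrict dual hwdual
    have hΨker : LinearMap.ker Ψ = LinearMap.range (Matrix.toLin' G) := by
      ext p
      have : p ∈ LinearMap.ker Ψ ↔ w p ∈ hperpLat := by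
        simp [Ψ, LinearMap.mem_ker]
      rw [this, memPerp, LinearMap.mem_range]
      constructor
      · rintro ⟨hint, -⟩
        obtain ⟨y0, h0⟩ := hint (.inr 0)
        obtain ⟨y2, h2⟩ := hint (.inr 2)
        refine ⟨![y0, y2], ?_⟩
        ext i
        have e0 := hpair0 p
        have e1 := hpair1 p
        rw [← h0, ← h2] at e0 e1
        have e0' : -2 * b * y0 + s * c * y2 = p 0 := mod_cast e0
        have e1' : s * c * y0 - γ * s * y2 = p 1 := mod_cast e1
        fin_cases i
        · simp [G, Matrix.vecHead, Matrix.vecTail]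
          linear_combination e0'
        · simp [G, Matrix.vecHead, Matrix.vecTail]
          linear_combination e1'
      · rintro ⟨q, rfl⟩
        refine ⟨?_, hwker _⟩
        have hG0 : Matrix.toLin' G q 0 = -2 * b * q 0 + s * c * q 1 := by
          simp [G, Matrix.mulVec, dotProduct]
        have hG1 : Matrix.toLin' G q 1 = s * c * q 0 - γ * s * q 1 := by
          simp [G, Matrix.mulVec, dotProduct]
          ring
        rintro (i | i)
        · exact ⟨0, by simp [hw]⟩
        · rw [hw, hG0, hG1]
          fin_cases i
          · refine ⟨q 0, ?_⟩
            simp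
            field_simp
            rw [hDQ]
            ring
          · refine ⟨-b * q 0 + s * c * q 1, ?_⟩
            simp
            field_simp
            rw [hDQ]
            ring
          · refine ⟨q 1, ?_⟩
            simp
            field_simp
            rw [hDQ]
            ring
    have hΨsurj : Function.Surjective Ψ := by
      intro x
      obtain ⟨⟨x, hx⟩, rfl⟩ := Submodule.Quotient.mk_surjective _ x
      obtain ⟨hxker, hxint⟩ := (memDual x).1 hx
      have hxinl : ∀ i, ∃ m : ℤ, (m : ℚ) = x (.inl i) := by
        refine Matrix.exists_intCast_of_vecMul GM hunimod (fun i => x (.inl i)) fun i => ?_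
        have he : Sum.elim (Pi.single i 1) 0 ∈ hperpLat := by
          refine (memPerp _).2 ⟨?_, by simp⟩
          rintro (j | j)
          · exact ⟨(Pi.single i 1 : Fin r → ℤ) j, by simp [Pi.single_apply]⟩
          · exact ⟨0, by simp⟩
        obtain ⟨n, hn⟩ := hxint _ he
        refine ⟨n, ?_⟩
        rw [← hn, hBapply]
        simp [Matrix.vecMul, dotProduct]
      obtain ⟨p0, hp0⟩ := hxint (Sum.elim (0 : Fin r → ℚ) ![1, -b, 0]) <| (memPerp _).2 <| by
        refine ⟨?_, by simp⟩
        rintro (i | i)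
        · exact ⟨0, by simp⟩
        · exact ⟨![1, -b, 0] i, by fin_cases i <;> simp⟩
      obtain ⟨p1, hp1⟩ := hxint (Sum.elim (0 : Fin r → ℚ) ![0, s * c, 1]) <| (memPerp _).2 <| by
        refine ⟨?_, by simp⟩
        rintro (i | i)
        · exact ⟨0, by simp⟩
        · exact ⟨![0, s * c, 1] i, by fin_cases i <;> simp⟩
      have hzero : (fun _ : Fin r => (0 : ℚ)) = 0 := rfl
      simp [hBapply, hzero] at hp0 hp1
      have hx1 : x (.inr 1) = s * c * x (.inr 2) - b * x (.inr 0) := by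
        linear_combination hxker
      rw [hx1] at hp0
      refine ⟨![p0, p1], ?_⟩
      rw [eq_comm]
      refine (Submodule.Quotient.eq _).2 ((memPerp _).2 ⟨?_, ?_⟩)
      · rintro (i | i)
        · obtain ⟨m, hm⟩ := hxinl i
          exact ⟨m, by simp [hw, hm]⟩
        · refine ⟨0, ?_⟩
          fin_cases i
          · simp [hw, ← hp0, ← hp1]
            field_simp
            rw [hDQ]
            ring
          · simp [hw, ← hp0, ← hp1, hx1]
            field_simp
            rw [hDQ]
            ring
          · simp [hw, ← hp0, ← hp1]
            field_simp
            rw [hDQ]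
            ring
      · have := hwker ![p0, p1]
        simp
        linear_combination hxker - this
    have hGinj : Function.Injective (Matrix.toLin' G) := by
      refine Matrix.mulVec_injective_of_det_ne_zero ?_
      rw [hdetG]
      exact (mul_pos hDpos hspos).ne'
    rw [← Nat.card_congr (Ψ.quotKerEquivOfSurjective hΨsurj).toEquiv, hΨker,
      LinearMap.card_quotient_range_of_injective _ hGinj, LinearMap.det_toLin', hdetG]
    have := mul_pos hDpos hspos
    omega
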